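/- For all reals a⁻, a⁺ with 1 < a⁻ ≤ a⁺, there exist constants c, C > 0 depending only on a⁻ and a⁺ such that for every integer N ≥ 1 the spectral gap λ of the Metropolis chain for π_{a⁻,a⁺} on {−N,…,N} satisfies c/N^{1+a⁻} ≤ λ ≤ C/N^{1+a⁻}. -/

import Mathlib

open Finset

/-- The unnormalized density `F(x) = (1+|x|)^{a⁻}` for `x ≤ 0` and
`(1+|x|)^{a⁺}` for `x > 0` on `ℤ`. -/
noncomputable def metroF (am ap : ℝ) (x : ℤ) : ℝ :=
  if x ≤ 0 then ((1 + |x| : ℤ) : ℝ) ^ am else ((1 + |x| : ℤ) : ℝ) ^ ap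

/-- The probability measure on `{-N⁻,…,N⁺}` proportional to `metroF`. -/
noncomputable def metroPi (am ap : ℝ) (Nm Np : ℤ) (x : ℤ) : ℝ :=
  metroF am ap x / ∑ y ∈ Finset.Icc (-Nm) Np, metroF am ap y

/-- Dirichlet form of the Metropolis chain for `metroPi` based on
nearest-neighbor random walk on `{-N⁻,…,N⁺}`. -/
noncomputable def metroDirichlet (am ap : ℝ) (Nm Np : ℤ) (u : ℤ → ℝ) : ℝ :=
  ∑ x ∈ Finset.Icc (-Nm) (Np - 1),
    (u (x + 1) - u x) ^ 2 *
      (1 / 2 * min (metroPi am ap Nm Np x) (metroPi am ap Nm Np (x + 1)))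

/-- Variance with respect to `metroPi`. -/
noncomputable def metroVar (am ap : ℝ) (Nm Np : ℤ) (u : ℤ → ℝ) : ℝ :=
  ∑ x ∈ Finset.Icc (-Nm) Np,
    (u x - ∑ y ∈ Finset.Icc (-Nm) Np, u y * metroPi am ap Nm Np y) ^ 2 *
      metroPi am ap Nm Np x

/-- Spectral gap of the Metropolis chain:
`λ = inf { ℰ(u,u)/Var_π(u) : Var_π(u) ≠ 0 }`. -/
noncomputable def metroGap (am ap : ℝ) (Nm Np : ℤ) : ℝ :=
  sInf {r : ℝ | ∃ u : ℤ → ℝ, metroVar am ap Nm Np u ≠ 0 ∧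
    r = metroDirichlet am ap Nm Np u / metroVar am ap Nm Np u}

lemma metroF_pos (am ap : ℝ) (x : ℤ) : 0 < metroF am ap x := by
  have h : (0 : ℝ) < ((1 + |x| : ℤ) : ℝ) := by
    exact_mod_cast (by positivity : (0 : ℤ) < 1 + |x|)
  unfold metroF
  split_ifs <;> positivity

lemma metroF_of_nonpos (am ap : ℝ) {x : ℤ} (hx : x ≤ 0) :
    metroF am ap x = (1 - x : ℝ) ^ am := by
  simp [metroF, hx, abs_of_nonpos, sub_eq_add_neg]

lemma metroF_of_nonneg (am ap : ℝ) {x : ℤ} (hx : 0 ≤ x) :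
    metroF am ap x = (1 + x : ℝ) ^ ap := by
  rcases hx.eq_or_lt with rfl | h
  · simp [metroF]
  · simp [metroF, not_le.2 h, abs_of_pos h]

lemma metroF_mono_of_nonneg (am : ℝ) {ap : ℝ} (hp : 0 ≤ ap) {x y : ℤ} (hx : 0 ≤ x)
    (hxy : x ≤ y) : metroF am ap x ≤ metroF am ap y := by
  rw [metroF_of_nonneg _ _ hx, metroF_of_nonneg _ _ (hx.trans hxy)]
  have hx' : (0 : ℝ) ≤ x := by exact_mod_cast hx
  have hxy' : (x : ℝ) ≤ y := by exact_mod_cast hxy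
  gcongr

lemma metroF_anti_of_nonpos {am : ℝ} (ap : ℝ) (hm : 0 ≤ am) {x y : ℤ} (hy : y ≤ 0)
    (hxy : x ≤ y) : metroF am ap y ≤ metroF am ap x := by
  rw [metroF_of_nonpos _ _ hy, metroF_of_nonpos _ _ (hxy.trans hy)]
  have hy' : (y : ℝ) ≤ 0 := by exact_mod_cast hy
  have hxy' : (x : ℝ) ≤ y := by exact_mod_cast hxy
  gcongr
  linarith

/-- The unnormalized conductance of the edge between `x` and `x + 1`. -/
noncomputable def metroEdge (am ap : ℝ) (x : ℤ) : ℝ :=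
  min (metroF am ap x) (metroF am ap (x + 1))

lemma metroEdge_pos (am ap : ℝ) (x : ℤ) : 0 < metroEdge am ap x :=
  lt_min (metroF_pos _ _ _) (metroF_pos _ _ _)

lemma metroEdge_of_nonneg (am : ℝ) {ap : ℝ} (hp : 0 ≤ ap) {x : ℤ} (hx : 0 ≤ x) :
    metroEdge am ap x = metroF am ap x :=
  min_eq_left (metroF_mono_of_nonneg am hp hx (by lia))

lemma metroEdge_of_neg {am : ℝ} (ap : ℝ) (hm : 0 ≤ am) {x : ℤ} (hx : x < 0) :
    metroEdge am ap x = metroF am ap (x + 1) :=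
  min_eq_right (metroF_anti_of_nonpos ap hm (by lia) (by lia))

lemma summable_inv_metroEdge {am ap : ℝ} (hm : 1 < am) (hp : 1 < ap) :
    Summable fun x : ℤ => (metroEdge am ap x)⁻¹ := by
  have key : ∀ a : ℝ, 1 < a → Summable fun n : ℕ => ((1 + n : ℝ) ^ a)⁻¹ := fun a ha => by
    simpa [add_comm] using (summable_nat_add_iff 1).2 (Real.summable_nat_rpow_inv.2 ha)
  refine Summable.of_nat_of_neg_add_one ?_ ?_
  · refine (key ap hp).congr fun n => ?_
    rw [metroEdge_of_nonneg am (by linarith) (by lia), metroF_of_nonneg _ _ (by lia)]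
    simp
  · refine (key am hm).congr fun n => ?_
    rw [metroEdge_of_neg ap (by linarith) (by lia), metroF_of_nonpos _ _ (by lia)]
    simp

lemma sum_Ico_int_sub (u : ℤ → ℝ) {x n : ℤ} (h : x ≤ n) :
    ∑ y ∈ Finset.Ico x n, (u (y + 1) - u y) = u n - u x := by
  induction n, h using Int.leInduction with
  | base => simp
  | succ k hk ih =>
    have : Finset.Ico x (k + 1) = insert k (Finset.Ico x k) := by
      ext; simp; lia
    rw [this, Finset.sum_insert (by simp), ih]
    ring

lemma sq_sub_le_energy_mul_resistance {w : ℤ → ℝ} (hw : ∀ x, 0 < w x) (u : ℤ → ℝ)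
    {a x n : ℤ} (hax : a ≤ x) (hxn : x ≤ n) :
    (u x - u n) ^ 2 ≤ (∑ y ∈ Finset.Icc a (n - 1), (u (y + 1) - u y) ^ 2 * w y) *
      ∑ y ∈ Finset.Ico x n, (w y)⁻¹ := by
  have hsub : Finset.Ico x n ⊆ Finset.Icc a (n - 1) := by
    intro y; simp only [Finset.mem_Ico, Finset.mem_Icc]; lia
  calc (u x - u n) ^ 2 = (∑ y ∈ Finset.Ico x n, (u (y + 1) - u y)) ^ 2 := by
        rw [sum_Ico_int_sub u hxn]; ring
    _ ≤ (∑ y ∈ Finset.Ico x n, (u (y + 1) - u y) ^ 2 * w y) *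
        ∑ y ∈ Finset.Ico x n, (w y)⁻¹ :=
      Finset.sum_sq_le_sum_mul_sum_of_sq_le_mul _
        (fun y _ => mul_nonneg (sq_nonneg _) (hw y).le) (fun y _ => (inv_pos.2 (hw y)).le)
        (fun y _ => (mul_inv_cancel_right₀ (hw y).ne' _).ge)
    _ ≤ _ := mul_le_mul_of_nonneg_right
      (Finset.sum_le_sum_of_subset_of_nonneg hsub
        fun y _ _ => mul_nonneg (sq_nonneg _) (hw y).le)
      (Finset.sum_nonneg fun y _ => (inv_pos.2 (hw y)).le)

lemma sum_sq_sub_mean_le {ι : Type*} (s : Finset ι) (p u : ι → ℝ) (hp : ∑ i ∈ s, p i = 1)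
    (c : ℝ) :
    ∑ i ∈ s, (u i - ∑ j ∈ s, u j * p j) ^ 2 * p i ≤ ∑ i ∈ s, (u i - c) ^ 2 * p i := by
  set m := ∑ j ∈ s, u j * p j with hm
  have h : ∑ i ∈ s, (u i - c) ^ 2 * p i =
      ∑ i ∈ s, (u i - m) ^ 2 * p i + 2 * (m - c) * ∑ i ∈ s, u i * p i +
        (c ^ 2 - m ^ 2) * ∑ i ∈ s, p i := by
    rw [Finset.mul_sum, Finset.mul_sum, ← Finset.sum_add_distrib, ← Finset.sum_add_distrib]
    exact Finset.sum_congr rfl fun i _ => by ring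
  rw [hp, ← hm] at h
  nlinarith [sq_nonneg (m - c)]

lemma sum_Icc_metroF_pos (am ap : ℝ) {N : ℤ} (hN : 1 ≤ N) :
    0 < ∑ x ∈ Finset.Icc (-N) N, metroF am ap x :=
  Finset.sum_pos (fun x _ => metroF_pos am ap x) ⟨0, by simp; lia⟩

lemma metroDirichlet_eq (am ap : ℝ) {N : ℤ} (hN : 1 ≤ N) (u : ℤ → ℝ) :
    metroDirichlet am ap N N u =
      (∑ x ∈ Finset.Icc (-N) (N - 1), (u (x + 1) - u x) ^ 2 * metroEdge am ap x) /
        (2 * ∑ x ∈ Finset.Icc (-N) N, metroF am ap x) := by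
  have hZ := sum_Icc_metroF_pos am ap hN
  unfold metroDirichlet metroPi metroEdge
  rw [Finset.sum_div]
  refine Finset.sum_congr rfl fun x _ => ?_
  rw [min_div_div_right hZ.le]
  field_simp

lemma sum_metroPi (am ap : ℝ) {N : ℤ} (hN : 1 ≤ N) :
    ∑ x ∈ Finset.Icc (-N) N, metroPi am ap N N x = 1 := by
  unfold metroPi
  rw [← Finset.sum_div, div_self (sum_Icc_metroF_pos am ap hN).ne']

lemma metroPi_pos (am ap : ℝ) {N : ℤ} (hN : 1 ≤ N) (x : ℤ) : 0 < metroPi am ap N N x :=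
  div_pos (metroF_pos _ _ _) (sum_Icc_metroF_pos am ap hN)

lemma metroDirichlet_nonneg (am ap : ℝ) {N : ℤ} (hN : 1 ≤ N) (u : ℤ → ℝ) :
    0 ≤ metroDirichlet am ap N N u :=
  Finset.sum_nonneg fun x _ => mul_nonneg (sq_nonneg _) <| mul_nonneg (by norm_num) <|
    (lt_min (metroPi_pos am ap hN x) (metroPi_pos am ap hN (x + 1))).le

lemma metroVar_nonneg (am ap : ℝ) {N : ℤ} (hN : 1 ≤ N) (u : ℤ → ℝ) :
    0 ≤ metroVar am ap N N u :=
  Finset.sum_nonneg fun x _ => mul_nonneg (sq_nonneg _) (metroPi_pos am ap hN x).le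

lemma Icc_neg_eq_union {N : ℤ} (hN : 1 ≤ N) :
    Finset.Icc (-N) N = Finset.Icc (-N) 0 ∪ Finset.Icc 1 N := by
  ext; simp; lia

lemma disjoint_Icc_nonpos_pos (N : ℤ) : Disjoint (Finset.Icc (-N) 0) (Finset.Icc 1 N) := by
  rw [Finset.disjoint_left]; intro x; simp; lia

lemma sum_Icc_pos_le {am ap : ℝ} (hp : 0 ≤ ap) {N : ℤ} (hN : 1 ≤ N) (u : ℤ → ℝ) :
    ∑ x ∈ Finset.Icc 1 N, (u x - u N) ^ 2 * metroF am ap x ≤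
      (N : ℝ) ^ 2 *
        ∑ x ∈ Finset.Icc (-N) (N - 1), (u (x + 1) - u x) ^ 2 * metroEdge am ap x := by
  set E := ∑ x ∈ Finset.Icc (-N) (N - 1), (u (x + 1) - u x) ^ 2 * metroEdge am ap x
  have hE0 : 0 ≤ E :=
    Finset.sum_nonneg fun x _ => mul_nonneg (sq_nonneg _) (metroEdge_pos am ap x).le
  have hN' : (1 : ℝ) ≤ N := by exact_mod_cast hN
  have hterm : ∀ x ∈ Finset.Icc 1 N, (u x - u N) ^ 2 * metroF am ap x ≤ N * E := by
    intro x hx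
    rw [Finset.mem_Icc] at hx
    have hF := metroF_pos am ap x
    have hR : ∑ y ∈ Finset.Ico x N, (metroEdge am ap y)⁻¹ ≤ N * (metroF am ap x)⁻¹ := by
      calc _ ≤ ∑ y ∈ Finset.Ico x N, (metroF am ap x)⁻¹ := by
            refine Finset.sum_le_sum fun y hy => ?_
            rw [Finset.mem_Ico] at hy
            rw [metroEdge_of_nonneg am hp (by lia)]
            exact inv_anti₀ hF (metroF_mono_of_nonneg am hp (by lia) hy.1)
        _ = ((N - x).toNat : ℝ) * (metroF am ap x)⁻¹ := by simp
        _ ≤ _ := by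
            gcongr
            exact_mod_cast (by lia : ((N - x).toNat : ℤ) ≤ N)
    calc _ ≤ (E * (N * (metroF am ap x)⁻¹)) * metroF am ap x := by
          gcongr
          exact (sq_sub_le_energy_mul_resistance (metroEdge_pos am ap) u
            (a := -N) (by lia) hx.2).trans (mul_le_mul_of_nonneg_left hR hE0)
      _ = N * E := by field_simp
  refine (Finset.sum_le_card_nsmul _ _ _ hterm).trans_eq ?_
  have hc : ((N.toNat : ℕ) : ℝ) = N := by
    exact_mod_cast (by lia : ((N.toNat : ℕ) : ℤ) = N)
  simp only [Int.card_Icc, nsmul_eq_mul, add_sub_cancel_right, hc]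
  ring

lemma sum_Icc_nonpos_metroF_le {am : ℝ} (ap : ℝ) (hm : 0 ≤ am) {N : ℤ} (hN : 1 ≤ N) :
    ∑ x ∈ Finset.Icc (-N) 0, metroF am ap x ≤ 2 ^ (1 + am) * (N : ℝ) ^ (1 + am) := by
  have hN' : (1 : ℝ) ≤ N := by exact_mod_cast hN
  have hterm : ∀ x ∈ Finset.Icc (-N) 0, metroF am ap x ≤ (2 * N : ℝ) ^ am := by
    intro x hx
    rw [Finset.mem_Icc] at hx
    rw [metroF_of_nonpos _ _ hx.2]
    have h1 : (-N : ℝ) ≤ x := by exact_mod_cast hx.1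
    have h2 : (x : ℝ) ≤ 0 := by exact_mod_cast hx.2
    exact Real.rpow_le_rpow (by linarith) (by linarith) hm
  refine (Finset.sum_le_card_nsmul _ _ _ hterm).trans ?_
  rw [← Real.mul_rpow (by norm_num) (by linarith), Real.rpow_add (by linarith), Real.rpow_one,
    nsmul_eq_mul]
  gcongr
  rw [Int.card_Icc]
  exact_mod_cast (by lia : ((0 + 1 - -N).toNat : ℤ) ≤ 2 * N)

lemma sum_Icc_nonpos_le {am ap : ℝ} (hm : 1 < am) (hp : 1 < ap) {N : ℤ} (hN : 1 ≤ N)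
    (u : ℤ → ℝ) :
    ∑ x ∈ Finset.Icc (-N) 0, (u x - u N) ^ 2 * metroF am ap x ≤
      (∑' x : ℤ, (metroEdge am ap x)⁻¹) * (2 ^ (1 + am) * (N : ℝ) ^ (1 + am)) *
        ∑ x ∈ Finset.Icc (-N) (N - 1), (u (x + 1) - u x) ^ 2 * metroEdge am ap x := by
  set E := ∑ x ∈ Finset.Icc (-N) (N - 1), (u (x + 1) - u x) ^ 2 * metroEdge am ap x
  set T := ∑' x : ℤ, (metroEdge am ap x)⁻¹
  have hE0 : 0 ≤ E :=
    Finset.sum_nonneg fun x _ => mul_nonneg (sq_nonneg _) (metroEdge_pos am ap x).le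
  have hi : ∀ x, 0 ≤ (metroEdge am ap x)⁻¹ := fun x => (inv_pos.2 (metroEdge_pos am ap x)).le
  have hT0 : 0 ≤ T := tsum_nonneg hi
  calc _ ≤ ∑ x ∈ Finset.Icc (-N) 0, (E * T) * metroF am ap x := by
        refine Finset.sum_le_sum fun x hx => ?_
        rw [Finset.mem_Icc] at hx
        have hF := metroF_pos am ap x
        gcongr
        refine (sq_sub_le_energy_mul_resistance (metroEdge_pos am ap) u hx.1
          (by lia)).trans (mul_le_mul_of_nonneg_left ?_ hE0)
        exact (summable_inv_metroEdge hm hp).sum_le_tsum _ fun y _ => hi y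
    _ = (E * T) * ∑ x ∈ Finset.Icc (-N) 0, metroF am ap x := by rw [Finset.mul_sum]
    _ ≤ (E * T) * (2 ^ (1 + am) * (N : ℝ) ^ (1 + am)) := by
        gcongr
        exact sum_Icc_nonpos_metroF_le ap (by linarith) hN
    _ = _ := by ring

/-- Poincaré inequality for the Metropolis chain. -/
lemma metroVar_le {am ap : ℝ} (hm : 1 < am) (hp : 1 < ap) {N : ℤ} (hN : 1 ≤ N) (u : ℤ → ℝ) :
    metroVar am ap N N u ≤
      2 * ((∑' x : ℤ, (metroEdge am ap x)⁻¹) * 2 ^ (1 + am) + 1) * (N : ℝ) ^ (1 + am) *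
        metroDirichlet am ap N N u := by
  have hZ := sum_Icc_metroF_pos am ap hN
  refine (sum_sq_sub_mean_le _ _ u (sum_metroPi am ap hN) (u N)).trans ?_
  rw [metroDirichlet_eq am ap hN]
  have hneg := sum_Icc_nonpos_le hm hp hN u
  have hpos := sum_Icc_pos_le (am := am) (by linarith : 0 ≤ ap) hN u
  set E := ∑ x ∈ Finset.Icc (-N) (N - 1), (u (x + 1) - u x) ^ 2 * metroEdge am ap x
  have hE0 : 0 ≤ E :=
    Finset.sum_nonneg fun x _ => mul_nonneg (sq_nonneg _) (metroEdge_pos am ap x).le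
  have hN' : (1 : ℝ) ≤ N := by exact_mod_cast hN
  have hpow : (N : ℝ) ^ 2 ≤ (N : ℝ) ^ (1 + am) := by
    rw [← Real.rpow_two]
    exact Real.rpow_le_rpow_of_exponent_le hN' (by linarith)
  have hsum : ∑ x ∈ Finset.Icc (-N) N, (u x - u N) ^ 2 * metroPi am ap N N x =
      (∑ x ∈ Finset.Icc (-N) 0, (u x - u N) ^ 2 * metroF am ap x +
        ∑ x ∈ Finset.Icc 1 N, (u x - u N) ^ 2 * metroF am ap x) /
        ∑ x ∈ Finset.Icc (-N) N, metroF am ap x := by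
    rw [← Finset.sum_union (disjoint_Icc_nonpos_pos N), ← Icc_neg_eq_union hN, Finset.sum_div]
    exact Finset.sum_congr rfl fun x _ => by unfold metroPi; ring
  rw [hsum, mul_div_assoc', div_le_div_iff₀ hZ (by positivity)]
  have hE' := mul_le_mul_of_nonneg_right hpow hE0
  have := mul_le_mul_of_nonneg_right (add_le_add hneg (hpos.trans hE'))
    (mul_pos two_pos hZ).le
  refine this.trans_eq ?_
  ring

lemma rpow_one_add_le_sum_metroF {am ap : ℝ} {N : ℤ} (hN : 1 ≤ N)
    {s t : Finset ℤ} (hts : t ⊆ s) (hcard : N ≤ 2 * (t.card : ℤ))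
    (hF : ∀ x ∈ t, (N / 2 : ℝ) ^ am ≤ metroF am ap x) :
    (N / 2 : ℝ) ^ (1 + am) ≤ ∑ x ∈ s, metroF am ap x := by
  have hN' : (1 : ℝ) ≤ N := by exact_mod_cast hN
  have hcard' : (N : ℝ) ≤ 2 * t.card := by exact_mod_cast hcard
  calc (N / 2 : ℝ) ^ (1 + am) = N / 2 * (N / 2 : ℝ) ^ am := by
        rw [Real.rpow_add (by linarith), Real.rpow_one]
    _ ≤ t.card * (N / 2 : ℝ) ^ am := by gcongr; linarith
    _ = t.card • (N / 2 : ℝ) ^ am := by rw [nsmul_eq_mul]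
    _ ≤ ∑ x ∈ t, metroF am ap x := Finset.card_nsmul_le_sum _ _ _ hF
    _ ≤ _ := Finset.sum_le_sum_of_subset_of_nonneg hts fun x _ _ => (metroF_pos _ _ _).le

lemma le_sum_Icc_nonpos_metroF {am : ℝ} (ap : ℝ) (hm : 0 ≤ am) {N : ℤ} (hN : 1 ≤ N) :
    (N / 2 : ℝ) ^ (1 + am) ≤ ∑ x ∈ Finset.Icc (-N) 0, metroF am ap x := by
  have hN' : (1 : ℝ) ≤ N := by exact_mod_cast hN
  refine rpow_one_add_le_sum_metroF hN (t := Finset.Icc (-N) (-(N / 2)))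
    (Finset.Icc_subset_Icc_right (by lia)) (by rw [Int.card_Icc]; lia) fun x hx => ?_
  rw [Finset.mem_Icc] at hx
  rw [metroF_of_nonpos _ _ (by lia)]
  have h : (N : ℝ) ≤ 2 * (1 - x) := by exact_mod_cast (by lia : N ≤ 2 * (1 - x))
  exact Real.rpow_le_rpow (by linarith) (by linarith) hm

lemma le_sum_Icc_pos_metroF {am ap : ℝ} (hm : 0 ≤ am) (hle : am ≤ ap) {N : ℤ} (hN : 1 ≤ N) :
    (N / 2 : ℝ) ^ (1 + am) ≤ ∑ x ∈ Finset.Icc 1 N, metroF am ap x := by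
  have hN' : (1 : ℝ) ≤ N := by exact_mod_cast hN
  refine rpow_one_add_le_sum_metroF hN (t := Finset.Icc (N / 2 + 1) N)
    (Finset.Icc_subset_Icc_left (by lia)) (by rw [Int.card_Icc]; lia) fun x hx => ?_
  rw [Finset.mem_Icc] at hx
  rw [metroF_of_nonneg _ _ (by lia)]
  have h : (N : ℝ) ≤ 2 * (1 + x) := by exact_mod_cast (by lia : N ≤ 2 * (1 + x))
  have hx1 : (1 : ℝ) ≤ 1 + x := by exact_mod_cast (by lia : 1 ≤ 1 + x)
  exact (Real.rpow_le_rpow (by linarith) (by linarith) hm).trans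
    (Real.rpow_le_rpow_of_exponent_le hx1 hle)

/-- The indicator of the nonpositive half-line, the test function for the upper bound. -/
noncomputable def nonposIndicator (x : ℤ) : ℝ := if x ≤ 0 then 1 else 0

lemma metroDirichlet_nonposIndicator (am : ℝ) {ap : ℝ} (hp : 0 ≤ ap) {N : ℤ} (hN : 1 ≤ N) :
    metroDirichlet am ap N N nonposIndicator =
      1 / (2 * ∑ x ∈ Finset.Icc (-N) N, metroF am ap x) := by
  rw [metroDirichlet_eq am ap hN, Finset.sum_eq_single 0]
  · rw [metroEdge_of_nonneg am hp le_rfl]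
    simp [nonposIndicator, metroF]
  · intro x _ hx
    have : nonposIndicator (x + 1) = nonposIndicator x := by
      unfold nonposIndicator
      congr 1
      simp only [eq_iff_iff]
      lia
    simp [this]
  · simp; lia

lemma le_metroVar_nonposIndicator (am ap : ℝ) {N : ℤ} (hN : 1 ≤ N) :
    (∑ x ∈ Finset.Icc (-N) 0, metroF am ap x) * (∑ x ∈ Finset.Icc 1 N, metroF am ap x) /
      (∑ x ∈ Finset.Icc (-N) N, metroF am ap x) ^ 2 ≤
      metroVar am ap N N nonposIndicator := by
  have hZ := sum_Icc_metroF_pos am ap hN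
  unfold metroVar
  set m := ∑ y ∈ Finset.Icc (-N) N, nonposIndicator y * metroPi am ap N N y
  have hsplit : ∑ x ∈ Finset.Icc (-N) N, metroF am ap x =
      ∑ x ∈ Finset.Icc (-N) 0, metroF am ap x + ∑ x ∈ Finset.Icc 1 N, metroF am ap x := by
    rw [Icc_neg_eq_union hN, Finset.sum_union (disjoint_Icc_nonpos_pos N)]
  have hvar : ∑ x ∈ Finset.Icc (-N) N, (nonposIndicator x - m) ^ 2 * metroPi am ap N N x =
      ((1 - m) ^ 2 * ∑ x ∈ Finset.Icc (-N) 0, metroF am ap x +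
        m ^ 2 * ∑ x ∈ Finset.Icc 1 N, metroF am ap x) /
        ∑ x ∈ Finset.Icc (-N) N, metroF am ap x := by
    rw [Finset.mul_sum, Finset.mul_sum, add_div, Finset.sum_div, Finset.sum_div]
    conv_lhs => rw [Icc_neg_eq_union hN, Finset.sum_union (disjoint_Icc_nonpos_pos N)]
    congr 1 <;> refine Finset.sum_congr rfl fun x hx => ?_ <;> rw [Finset.mem_Icc] at hx
    · simp [nonposIndicator, hx.2, metroPi, mul_div_assoc]
    · simp [nonposIndicator, show ¬ x ≤ 0 by lia, metroPi, mul_div_assoc]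
  rw [hvar, div_le_div_iff₀ (by positivity) hZ]
  set P := ∑ x ∈ Finset.Icc (-N) 0, metroF am ap x
  set Q := ∑ x ∈ Finset.Icc 1 N, metroF am ap x
  set Z := ∑ x ∈ Finset.Icc (-N) N, metroF am ap x
  have h : P * Q ≤ ((1 - m) ^ 2 * P + m ^ 2 * Q) * Z := by
    rw [hsplit]
    nlinarith [sq_nonneg ((1 - m) * P - m * Q)]
  calc P * Q * Z ≤ ((1 - m) ^ 2 * P + m ^ 2 * Q) * Z * Z := by gcongr
    _ = _ := by ring

/-- for `1 < a⁻ ≤ a⁺`, the spectral gap on `{-N,…,N}` is of order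
`1/N^{1+a⁻}`. -/
theorem gap_symmetric_supercritical (am ap : ℝ) (h1 : 1 < am) (hle : am ≤ ap) :
    ∃ c C : ℝ, 0 < c ∧ 0 < C ∧ ∀ N : ℤ, 1 ≤ N →
      c / (N : ℝ) ^ (1 + am) ≤ metroGap am ap N N ∧
      metroGap am ap N N ≤ C / (N : ℝ) ^ (1 + am) := by
  have hp : 1 < ap := h1.trans_le hle
  set T := ∑' x : ℤ, (metroEdge am ap x)⁻¹
  have hT0 : 0 ≤ T := tsum_nonneg fun x => (inv_pos.2 (metroEdge_pos am ap x)).le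
  have hK : 0 < 2 * (T * 2 ^ (1 + am) + 1) := by positivity
  refine ⟨(2 * (T * 2 ^ (1 + am) + 1))⁻¹, 2 ^ (1 + am), by positivity, by positivity,
    fun N hN => ?_⟩
  have hN' : (0 : ℝ) < N := by exact_mod_cast hN
  have hNpow : 0 < (N : ℝ) ^ (1 + am) := by positivity
  have hA : 0 < (N / 2 : ℝ) ^ (1 + am) := by positivity
  have hP := le_sum_Icc_nonpos_metroF ap (by linarith : 0 ≤ am) hN
  have hQ := le_sum_Icc_pos_metroF (by linarith : 0 ≤ am) hle hN
  have hZ := sum_Icc_metroF_pos am ap hN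
  have hV := le_metroVar_nonposIndicator am ap hN
  have hVpos : 0 < metroVar am ap N N nonposIndicator :=
    (div_pos (mul_pos (hA.trans_le hP) (hA.trans_le hQ)) (by positivity)).trans_le hV
  constructor
  · refine le_csInf ⟨_, nonposIndicator, hVpos.ne', rfl⟩ ?_
    rintro r ⟨u, hu, rfl⟩
    have hu' := (metroVar_nonneg am ap hN u).lt_of_ne' hu
    rw [le_div_iff₀ hu', div_mul_eq_mul_div, div_le_iff₀ hNpow, inv_mul_le_iff₀ hK]
    exact (metroVar_le h1 hp hN u).trans_eq (by ring)
  · have hbdd : BddBelow {r : ℝ | ∃ u : ℤ → ℝ, metroVar am ap N N u ≠ 0 ∧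
        r = metroDirichlet am ap N N u / metroVar am ap N N u} := by
      refine ⟨0, ?_⟩
      rintro r ⟨u, -, rfl⟩
      exact div_nonneg (metroDirichlet_nonneg am ap hN u) (metroVar_nonneg am ap hN u)
    refine (csInf_le hbdd ⟨nonposIndicator, hVpos.ne', rfl⟩).trans ?_
    rw [metroDirichlet_nonposIndicator am (by linarith) hN]
    have hsplit : ∑ x ∈ Finset.Icc (-N) N, metroF am ap x =
        ∑ x ∈ Finset.Icc (-N) 0, metroF am ap x + ∑ x ∈ Finset.Icc 1 N, metroF am ap x := by
      rw [Icc_neg_eq_union hN, Finset.sum_union (disjoint_Icc_nonpos_pos N)]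
    have hC : (2 : ℝ) ^ (1 + am) / (N : ℝ) ^ (1 + am) = 1 / (N / 2 : ℝ) ^ (1 + am) := by
      rw [Real.div_rpow hN'.le two_pos.le, one_div_div]
    rw [hC]
    set P := ∑ x ∈ Finset.Icc (-N) 0, metroF am ap x
    set Q := ∑ x ∈ Finset.Icc 1 N, metroF am ap x
    set Z := ∑ x ∈ Finset.Icc (-N) N, metroF am ap x
    set A := (N / 2 : ℝ) ^ (1 + am)
    have hP0 : 0 < P := hA.trans_le hP
    have hQ0 : 0 < Q := hA.trans_le hQ
    calc 1 / (2 * Z) / metroVar am ap N N nonposIndicator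
        ≤ 1 / (2 * Z) / (P * Q / Z ^ 2) := by gcongr
      _ = (1 / P + 1 / Q) / 2 := by
          field_simp
          rw [hsplit]
          ring
      _ ≤ (1 / A + 1 / A) / 2 := by gcongr
      _ = 1 / A := by ring
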